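/- Let d ≥ 1 and T > 0, and let φ : Fin d → ℝ → EuclideanSpace ℂ (Fin d) be continuously differentiable curves forming an orthonormal basis at each time and satisfying φ j T = φ j 0 for all j. Write e^{iγ_j} = exp( − ∫_0^T ⟪φ j s, deriv (φ j) s⟫ ds ) for the geometric phase factor of the j-th state. If there is an index k such that e^{iγ_j} = 1 for every j ≠ k, then also e^{iγ_k} = 1. In other words, no cyclic evolution exists for which exactly one state acquires a non-trivial geometric phase factor. -/

import Mathlib

open scoped InnerProductSpace

/-- **Jacobi's formula** for a basis-valued curve: the logarithmic derivative of the determinant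
of a moving orthonormal frame is the trace of its connection matrix. -/
theorem Orthonormal.hasDerivAt_det {ι E : Type*} [Fintype ι] [DecidableEq ι]
    [NormedAddCommGroup E] [InnerProductSpace ℂ E] (b : Module.Basis ι ℂ E)
    {φ : ι → ℝ → E} {φ' : ι → E} {t : ℝ} (hφ : ∀ i, HasDerivAt (φ i) (φ' i) t)
    (horth : Orthonormal ℂ fun i => φ i t) :
    HasDerivAt (fun s => b.det fun i => φ i s)
      ((∑ i, ⟪φ i t, φ' i⟫_ℂ) * b.det fun i => φ i t) t := by
  have : FiniteDimensional ℂ E := b.finiteDimensional_of_finite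
  let f : ContinuousMultilinearMap ℝ (fun _ : ι => E) ℂ :=
    { b.det.toMultilinearMap.restrictScalars ℝ with
      cont := by
        change Continuous fun v : ι → E => b.det v
        simp only [Module.Basis.det_apply]
        refine Continuous.matrix_det (continuous_matrix fun i j => ?_)
        exact (b.coord i).continuous_of_finiteDimensional.comp (continuous_apply j) }
  have hf : HasDerivAt (fun s => b.det fun i => φ i s)
      (f.linearDeriv (fun i => φ i t) φ') t :=
    (f.hasFDerivAt (fun i => φ i t)).comp_hasDerivAt t (hasDerivAt_pi.2 hφ)
  convert hf using 1
  rw [ContinuousMultilinearMap.linearDeriv_apply, Finset.sum_mul]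
  refine Finset.sum_congr rfl fun j _ => ?_
  change _ = b.det (Function.update (fun i => φ i t) j (φ' j))
  have hspan : ⊤ ≤ Submodule.span ℂ (Set.range fun i => φ i t) :=
    (horth.linearIndependent.span_eq_top_of_card_eq_finrank'
      (Module.finrank_eq_card_basis b).symm).ge
  have hrepr : φ' j = ∑ i, ⟪φ i t, φ' j⟫_ℂ • φ i t := by
    simpa using ((OrthonormalBasis.mk horth hspan).sum_repr' (φ' j)).symm
  conv_rhs => rw [hrepr]
  rw [AlternatingMap.map_update_sum, Finset.sum_eq_single j]
  · rw [AlternatingMap.map_update_smul, Function.update_eq_self, smul_eq_mul]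
  · intro i _ hij
    rw [AlternatingMap.map_update_smul, AlternatingMap.map_update_self _ _ hij.symm, smul_zero]
  · simp

/-- A solution of `u' = g u` satisfies `u t = exp (∫ g) u 0`. -/
theorem eq_exp_integral_mul_of_hasDerivAt {g u : ℝ → ℂ} (hg : Continuous g)
    (hu : ∀ t, HasDerivAt u (g t * u t) t) (a t : ℝ) :
    Complex.exp (-∫ s in a..t, g s) * u t = u a := by
  have hd : ∀ x, HasDerivAt (fun x => Complex.exp (-∫ s in a..x, g s) * u x) 0 x := fun x =>
    (((hg.integral_hasStrictDerivAt a x).hasDerivAt.fun_neg.cexp).fun_mul (hu x)).congr_deriv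
      (by ring)
  simpa using is_const_of_deriv_eq_zero (fun x => (hd x).differentiableAt)
    (fun x => (hd x).deriv) t a

/-- **Sum rule**: the geometric phase factors of a cyclic orthonormal basis multiply to one. -/
theorem prod_geometric_phase_factor_eq_one {ι E : Type*} [Fintype ι]
    [NormedAddCommGroup E] [InnerProductSpace ℂ E] (b : Module.Basis ι ℂ E)
    {φ : ι → ℝ → E} {T : ℝ} (hC1 : ∀ j, ContDiff ℝ 1 (φ j))
    (horth : ∀ s, Orthonormal ℂ fun j => φ j s) (hcyc : ∀ j, φ j T = φ j 0) :
    ∏ j, Complex.exp (-∫ s in (0 : ℝ)..T, ⟪φ j s, deriv (φ j) s⟫_ℂ) = 1 := by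
  classical
  have : FiniteDimensional ℂ E := b.finiteDimensional_of_finite
  have hcont : ∀ j, Continuous fun s => ⟪φ j s, deriv (φ j) s⟫_ℂ := fun j =>
    (hC1 j).continuous.inner ((hC1 j).continuous_deriv le_rfl)
  have hdet := eq_exp_integral_mul_of_hasDerivAt (continuous_finsetSum _ fun j _ => hcont j)
    (fun t => Orthonormal.hasDerivAt_det b
      (fun j => ((hC1 j).differentiable one_ne_zero t).hasDerivAt) (horth t)) 0 T
  have hne : (b.det fun j => φ j 0) ≠ 0 := by
    have hli := (horth 0).linearIndependent
    have hspan := hli.span_eq_top_of_card_eq_finrank' (Module.finrank_eq_card_basis b).symm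
    exact ((Module.Basis.is_basis_iff_det b).1 ⟨hli, hspan⟩).ne_zero
  simp only [hcyc] at hdet
  rw [← Complex.exp_sum, Finset.sum_neg_distrib,
    ← intervalIntegral.integral_finsetSum fun j _ => (hcont j).intervalIntegrable _ _]
  exact (mul_eq_right₀ hne).1 hdet

theorem no_single_nontrivial_geometric_phase
    {d : ℕ} (hd : 1 ≤ d) (T : ℝ) (hT : 0 < T)
    (φ : Fin d → ℝ → EuclideanSpace ℂ (Fin d))
    (hC1 : ∀ j, ContDiff ℝ 1 (φ j))
    (horth : ∀ s : ℝ, Orthonormal ℂ (fun j => φ j s))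
    (hcyc : ∀ j, φ j T = φ j 0)
    (k : Fin d)
    (htriv : ∀ j : Fin d, j ≠ k →
      Complex.exp (- ∫ s in (0:ℝ)..T, ⟪φ j s, deriv (φ j) s⟫_ℂ) = 1) :
    Complex.exp (- ∫ s in (0:ℝ)..T, ⟪φ k s, deriv (φ k) s⟫_ℂ) = 1 := by
  have hprod := prod_geometric_phase_factor_eq_one
    (EuclideanSpace.basisFun (Fin d) ℂ).toBasis hC1 horth hcyc
  rwa [Finset.prod_eq_single k (fun j _ hj => htriv j hj) (by simp)] at hprod
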